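/- arXiv:1406.0065 — 4 statements merged into one kernel-verified Lean document; each statement's English description precedes it below -/
import Mathlib

section
/- Let N ≥ 1 be a natural number and ε > 0. Suppose u : ℝ^N → ℝ is continuous on the closed ball {‖x‖ ≤ ε}, twice continuously differentiable on the open ball {‖x‖ < ε} with Δu = −1 there, and u(x) = 0 for every x with ‖x‖ = ε. Then u(x) = (ε² − ‖x‖²)/(2N) for every x in the closed ball {‖x‖ ≤ ε}. -/
/-- The Euclidean Laplacian: sum of second partial derivatives. -/
noncomputable def laplacian {N : ℕ} (f : EuclideanSpace ℝ (Fin N) → ℝ)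
    (x : EuclideanSpace ℝ (Fin N)) : ℝ :=
  ∑ i : Fin N,
    fderiv ℝ (fun y => fderiv ℝ f y (EuclideanSpace.single i (1 : ℝ))) x
      (EuclideanSpace.single i (1 : ℝ))

open Filter Topology

/-- The second directional derivative of a `C²` function is nonpositive at a local maximum. -/
theorem IsLocalMax.fderiv_fderiv_apply_nonpos {E : Type*} [NormedAddCommGroup E]
    [NormedSpace ℝ E] {f : E → ℝ} {x : E} (h : IsLocalMax f x) (hf : ContDiffAt ℝ 2 f x)
    (v : E) : fderiv ℝ (fun y => fderiv ℝ f y v) x v ≤ 0 := by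
  set line : ℝ → E := fun t => x + t • v with hline
  have hline0 : line 0 = x := by simp [hline]
  have hlineD (t : ℝ) : HasDerivAt line v t := by
    simpa [hline] using ((hasDerivAt_id t).smul_const v).const_add x
  have hlineT : Tendsto line (𝓝 0) (𝓝 x) := by
    simpa [hline0] using (hlineD 0).continuousAt.tendsto
  have hdiff : ∀ᶠ y in 𝓝 x, DifferentiableAt ℝ f y :=
    (hf.eventually (by simp)).mono fun y hy => hy.differentiableAt (by simp)
  have hderiv : deriv (f ∘ line) =ᶠ[𝓝 0] fun t => fderiv ℝ f (line t) v :=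
    (hlineT.eventually hdiff).mono fun t ht => (ht.hasFDerivAt.comp_hasDerivAt t (hlineD t)).deriv
  have hsecond : deriv (deriv (f ∘ line)) 0 = fderiv ℝ (fun y => fderiv ℝ f y v) x v := by
    have hd : DifferentiableAt ℝ (fun y => fderiv ℝ f y v) (line 0) := by
      rw [hline0]
      exact ((hf.fderiv_right (m := 1) (by norm_num)).differentiableAt (by simp)).clm_apply
        (differentiableAt_const v)
    rw [hderiv.deriv_eq]
    have := (hd.hasFDerivAt.comp_hasDerivAt (0 : ℝ) (hlineD 0)).deriv
    rw [hline0] at this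
    exact this
  have hmax : IsLocalMax (f ∘ line) 0 := by
    simpa [IsLocalMax, IsMaxFilter, hline0] using hlineT.eventually h
  rw [← hsecond]
  by_contra! hpos
  have hmin : IsLocalMin (f ∘ line) 0 :=
    isLocalMin_of_deriv_deriv_pos hpos hmax.deriv_eq_zero
      (ContinuousAt.comp (by rw [hline0]; exact hf.continuousAt) (hlineD 0).continuousAt)
  have hconst : f ∘ line =ᶠ[𝓝 0] fun _ => (f ∘ line) 0 := by
    filter_upwards [hmax, hmin] with t h₁ h₂ using le_antisymm h₁ h₂
  rw [hconst.deriv.deriv_eq] at hpos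
  simp at hpos

theorem fderiv_fderiv_add_mul_norm_sq_apply {E : Type*} [NormedAddCommGroup E]
    [InnerProductSpace ℝ E] {f : E → ℝ} {x : E} (hf : ContDiffAt ℝ 2 f x) (b : ℝ) (v : E) :
    fderiv ℝ (fun y => fderiv ℝ (fun z => f z + b * ‖z‖ ^ 2) y v) x v =
      fderiv ℝ (fun y => fderiv ℝ f y v) x v + 2 * b * ‖v‖ ^ 2 := by
  have hfirst : (fun y => fderiv ℝ (fun z => f z + b * ‖z‖ ^ 2) y v) =ᶠ[𝓝 x]
      fun y => fderiv ℝ f y v + (2 * b) * inner ℝ v y := by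
    filter_upwards [hf.eventually (by simp)] with y hy
    have h := (hy.differentiableAt (by simp)).hasFDerivAt.add
      ((hasStrictFDerivAt_norm_sq y).hasFDerivAt.const_mul b)
    rw [show (fun z => f z + b * ‖z‖ ^ 2) = f + fun z => b * ‖z‖ ^ 2 from rfl, h.fderiv]
    simp [real_inner_comm]
    ring
  have hd : DifferentiableAt ℝ (fun y => fderiv ℝ f y v) x :=
    ((hf.fderiv_right (m := 1) (by norm_num)).differentiableAt (by simp)).clm_apply
      (differentiableAt_const v)
  have h := hd.hasFDerivAt.add (((innerSL ℝ v).hasFDerivAt (x := x)).const_mul (2 * b))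
  rw [hfirst.fderiv_eq]
  refine (congrArg (fun L : E →L[ℝ] ℝ => L v) h.fderiv).trans ?_
  simp

theorem laplacian_add_mul_norm_sq {N : ℕ} {f : EuclideanSpace ℝ (Fin N) → ℝ}
    {x : EuclideanSpace ℝ (Fin N)} (hf : ContDiffAt ℝ 2 f x) (b : ℝ) :
    laplacian (fun y => f y + b * ‖y‖ ^ 2) x = laplacian f x + 2 * N * b := by
  simp only [laplacian, fderiv_fderiv_add_mul_norm_sq_apply hf, Finset.sum_add_distrib]
  simp
  ring

theorem laplacian_neg {N : ℕ} (f : EuclideanSpace ℝ (Fin N) → ℝ)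
    (x : EuclideanSpace ℝ (Fin N)) : laplacian (fun y => -f y) x = -laplacian f x := by
  simp [laplacian, fderiv_fun_neg]

theorem IsLocalMax.laplacian_nonpos {N : ℕ} {f : EuclideanSpace ℝ (Fin N) → ℝ}
    {x : EuclideanSpace ℝ (Fin N)} (h : IsLocalMax f x) (hf : ContDiffAt ℝ 2 f x) :
    laplacian f x ≤ 0 :=
  Finset.sum_nonpos fun _ _ => h.fderiv_fderiv_apply_nonpos hf _

/-- Comparison with a paraboloid: a function vanishing on the sphere of radius `ε` whose Laplacian
exceeds that of `b * (ε ^ 2 - ‖x‖ ^ 2)` lies below it. -/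
theorem le_mul_sub_norm_sq_of_laplacian_pos {N : ℕ} {ε b : ℝ} {f : EuclideanSpace ℝ (Fin N) → ℝ}
    (hcont : ContinuousOn f (Metric.closedBall 0 ε))
    (hC2 : ContDiffOn ℝ 2 f (Metric.ball 0 ε))
    (hlap : ∀ x ∈ Metric.ball (0 : EuclideanSpace ℝ (Fin N)) ε, 0 < laplacian f x + 2 * N * b)
    (hbd : ∀ x : EuclideanSpace ℝ (Fin N), ‖x‖ = ε → f x = 0)
    {x : EuclideanSpace ℝ (Fin N)} (hx : x ∈ Metric.closedBall 0 ε) :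
    f x ≤ b * (ε ^ 2 - ‖x‖ ^ 2) := by
  obtain ⟨z, hz, hmax⟩ := (isCompact_closedBall (0 : EuclideanSpace ℝ (Fin N)) ε).exists_isMaxOn
    ⟨x, hx⟩ (f := fun y => f y + b * ‖y‖ ^ 2) (hcont.add (by fun_prop))
  have hzε : ‖z‖ = ε := by
    refine le_antisymm (by simpa using hz) (not_lt.1 fun hlt => ?_)
    have hzball : z ∈ Metric.ball 0 ε := by simpa using hlt
    have hfz : ContDiffAt ℝ 2 f z := hC2.contDiffAt (Metric.isOpen_ball.mem_nhds hzball)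
    have hloc : IsLocalMax (fun y => f y + b * ‖y‖ ^ 2) z :=
      hmax.isLocalMax (mem_of_superset (Metric.isOpen_ball.mem_nhds hzball)
        Metric.ball_subset_closedBall)
    have hle := hloc.laplacian_nonpos (hfz.add (contDiffAt_const.mul (contDiffAt_id.norm_sq ℝ)))
    rw [laplacian_add_mul_norm_sq hfz] at hle
    exact (hlap z hzball).not_ge hle
  have hle : f x + b * ‖x‖ ^ 2 ≤ f z + b * ‖z‖ ^ 2 := hmax hx
  rw [hbd z hzε, hzε] at hle
  linarith

/-- The upper bound for the Dirichlet problem with constant Laplacian `c` on a ball. -/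
theorem le_of_laplacian_eq_const {N : ℕ} (hN : 1 ≤ N) {ε c : ℝ}
    {f : EuclideanSpace ℝ (Fin N) → ℝ}
    (hcont : ContinuousOn f (Metric.closedBall 0 ε))
    (hC2 : ContDiffOn ℝ 2 f (Metric.ball 0 ε))
    (hlap : ∀ x ∈ Metric.ball (0 : EuclideanSpace ℝ (Fin N)) ε, laplacian f x = c)
    (hbd : ∀ x : EuclideanSpace ℝ (Fin N), ‖x‖ = ε → f x = 0)
    {x : EuclideanSpace ℝ (Fin N)} (hx : x ∈ Metric.closedBall 0 ε) :
    f x ≤ -c / (2 * N) * (ε ^ 2 - ‖x‖ ^ 2) := by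
  have hN0 : (0 : ℝ) < 2 * N := by positivity
  have hlim : Tendsto (fun b : ℝ => b * (ε ^ 2 - ‖x‖ ^ 2)) (𝓝[>] (-c / (2 * N)))
      (𝓝 (-c / (2 * N) * (ε ^ 2 - ‖x‖ ^ 2))) :=
    (Continuous.tendsto (by fun_prop) _).mono_left nhdsWithin_le_nhds
  refine ge_of_tendsto hlim ?_
  filter_upwards [self_mem_nhdsWithin] with b hb
  refine le_mul_sub_norm_sq_of_laplacian_pos hcont hC2 (fun y hy => ?_) hbd hx
  have := (div_lt_iff₀ hN0).1 (Set.mem_Ioi.1 hb)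
  rw [hlap y hy]
  linarith

/-- Uniqueness for the Dirichlet torsion problem on the ball of radius ε:
any solution agrees with `(ε² − ‖x‖²)/(2N)`. -/
theorem torsion_problem_unique (N : ℕ) (hN : 1 ≤ N) (ε : ℝ) (hε : 0 < ε)
    (u : EuclideanSpace ℝ (Fin N) → ℝ)
    (hcont : ContinuousOn u (Metric.closedBall 0 ε))
    (hC2 : ContDiffOn ℝ 2 u (Metric.ball 0 ε))
    (hlap : ∀ x ∈ Metric.ball (0 : EuclideanSpace ℝ (Fin N)) ε, laplacian u x = -1)
    (hbd : ∀ x : EuclideanSpace ℝ (Fin N), ‖x‖ = ε → u x = 0) :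
    ∀ x ∈ Metric.closedBall (0 : EuclideanSpace ℝ (Fin N)) ε,
      u x = (ε ^ 2 - ‖x‖ ^ 2) / (2 * N) := by
  intro x hx
  have hupper := le_of_laplacian_eq_const hN hcont hC2 hlap hbd hx
  have hlower := le_of_laplacian_eq_const hN hcont.fun_neg hC2.neg (c := 1)
    (fun y hy => by rw [laplacian_neg, hlap y hy, neg_neg]) (fun y hy => by simp [hbd y hy]) hx
  rw [neg_neg] at hupper
  rw [neg_div, neg_mul] at hlower
  rw [div_eq_mul_one_div, mul_comm]
  linarith
end

section
/- Let N ≥ 1 be a natural number and let B₁ be the open unit ball in ℝ^N with Lebesgue volume |B₁|. Then J(B₁) = N(N+2)/|B₁|, i.e. the infimum of ∫ ‖∇u‖² dx over all smooth functions u : ℝ^N → ℝ with compact support contained in B₁ and with ∫ u dx = 1 equals N(N+2)/|B₁|. -/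
open MeasureTheory

/-- The torsional energy of an open set `Ω ⊆ ℝ^N`: the infimum of the Dirichlet energy
`∫ ‖∇u‖²` over smooth functions `u` with compact support contained in `Ω`
and with `∫ u = 1`. -/
noncomputable def torsionEnergy {N : ℕ} (Ω : Set (EuclideanSpace ℝ (Fin N))) : ℝ :=
  sInf { e : ℝ | ∃ u : EuclideanSpace ℝ (Fin N) → ℝ,
    ContDiff ℝ (⊤ : ℕ∞) u ∧ HasCompactSupport u ∧ tsupport u ⊆ Ω ∧
    (∫ x, u x) = 1 ∧ e = ∫ x, ‖gradient u x‖ ^ 2 }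

open Set Filter Topology

lemma integrableOn_ball_norm_sq {N : ℕ} :
    IntegrableOn (fun x : EuclideanSpace ℝ (Fin N) ↦ ‖x‖ ^ 2) (Metric.ball 0 1) :=
  ((continuous_norm.pow 2).continuousOn.integrableOn_compact
    (isCompact_closedBall 0 1)).mono_set Metric.ball_subset_closedBall

/-- The second moment of the unit ball of `ℝ^N`. -/
lemma setIntegral_ball_norm_sq {N : ℕ} (hN : 1 ≤ N) :
    ∫ x in Metric.ball (0 : EuclideanSpace ℝ (Fin N)) 1, ‖x‖ ^ 2 =
      N / (N + 2) * volume.real (Metric.ball (0 : EuclideanSpace ℝ (Fin N)) 1) := by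
  have : Nonempty (Fin N) := ⟨⟨0, hN⟩⟩
  have h := integral_fun_norm_addHaar (volume : Measure (EuclideanSpace ℝ (Fin N)))
    ((Iio (1 : ℝ)).indicator fun r ↦ r ^ 2)
  have hball : ∫ x in Metric.ball (0 : EuclideanSpace ℝ (Fin N)) 1, ‖x‖ ^ 2 =
      ∫ x : EuclideanSpace ℝ (Fin N), (Iio (1 : ℝ)).indicator (fun r ↦ r ^ 2) ‖x‖ := by
    rw [← integral_indicator Metric.isOpen_ball.measurableSet]
    congr 1 with x
    simp [indicator]
  have hradial : ∫ y in Ioi (0 : ℝ), y ^ (N - 1) • (Iio (1 : ℝ)).indicator (fun r ↦ r ^ 2) y =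
      1 / (N + 2) := by
    have hind : ∀ y : ℝ, y ^ (N - 1) • (Iio (1 : ℝ)).indicator (fun r ↦ r ^ 2) y =
        (Iio (1 : ℝ)).indicator (fun r ↦ r ^ (N + 1)) y := by
      intro y
      by_cases hy : y ∈ Iio (1 : ℝ)
      · simp only [indicator_of_mem hy, smul_eq_mul, ← pow_add]
        congr 1
        omega
      · simp [indicator_of_notMem hy]
    simp_rw [hind]
    rw [setIntegral_indicator measurableSet_Iio, Ioi_inter_Iio, ← integral_Ioc_eq_integral_Ioo,
      ← intervalIntegral.integral_of_le zero_le_one, integral_pow]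
    push_cast
    ring_nf
  rw [hball, h, finrank_euclideanSpace_fin, hradial]
  simp only [nsmul_eq_mul, smul_eq_mul]
  ring

lemma norm_gradient_eq_norm_fderiv {F : Type*} [NormedAddCommGroup F] [InnerProductSpace ℝ F]
    [CompleteSpace F] (u : F → ℝ) (x : F) : ‖gradient u x‖ = ‖fderiv ℝ u x‖ :=
  LinearIsometryEquiv.norm_map _ _

/-- Euler's identity `∫ x · ∇u = -N ∫ u` for compactly supported `u`. -/
lemma integral_fderiv_apply_self {N : ℕ} {u : EuclideanSpace ℝ (Fin N) → ℝ}
    (hu : ContDiff ℝ 1 u) (hc : HasCompactSupport u) :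
    ∫ x, fderiv ℝ u x x = -(N * ∫ x, u x) := by
  have hcont : ∀ v, Continuous fun x ↦ fderiv ℝ u x v := fun v ↦
    (hu.continuous_fderiv one_ne_zero).clm_apply continuous_const
  have hdiff : Differentiable ℝ u := hu.differentiable one_ne_zero
  set e := EuclideanSpace.basisFun (Fin N) ℝ with he
  have hint : ∀ i, Integrable (fun x : EuclideanSpace ℝ (Fin N) ↦ x i * fderiv ℝ u x (e i)) :=
    fun i ↦ (Continuous.mul (by fun_prop) (hcont (e i))).integrable_of_hasCompactSupport
      (hc.fderiv_apply (𝕜 := ℝ) (e i)).mul_left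
  have hcoord : ∀ (i : Fin N) (x : EuclideanSpace ℝ (Fin N)),
      fderiv ℝ (fun y : EuclideanSpace ℝ (Fin N) ↦ y i) x (e i) = 1 := by
    intro i x
    have : HasFDerivAt (fun y : EuclideanSpace ℝ (Fin N) ↦ y i)
      (EuclideanSpace.proj i : EuclideanSpace ℝ (Fin N) →L[ℝ] ℝ) x :=
      (EuclideanSpace.proj i : EuclideanSpace ℝ (Fin N) →L[ℝ] ℝ).hasFDerivAt
    rw [this.fderiv]
    simp [he]
  have huint : Integrable u := hu.continuous.integrable_of_hasCompactSupport hc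
  have hparts : ∀ i, ∫ x : EuclideanSpace ℝ (Fin N), x i * fderiv ℝ u x (e i) = -∫ x, u x := by
    intro i
    rw [integral_mul_fderiv_eq_neg_fderiv_mul_of_integrable]
    · simp [hcoord]
    · simpa [hcoord] using huint
    · exact hint i
    · exact (Continuous.mul (by fun_prop) hu.continuous).integrable_of_hasCompactSupport hc.mul_left
    · intro x _
      fun_prop
    · exact fun x _ ↦ hdiff x
  have hsum : ∀ x, fderiv ℝ u x x = ∑ i, x i * fderiv ℝ u x (e i) := by
    intro x
    calc fderiv ℝ u x x = fderiv ℝ u x (∑ i, x i • e i) := by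
          congr 1
          exact (e.sum_repr x).symm
      _ = ∑ i, x i * fderiv ℝ u x (e i) := by simp only [map_sum, map_smul, smul_eq_mul]
  simp_rw [hsum]
  rw [integral_finsetSum _ fun i _ ↦ hint i]
  simp [hparts]

/-- Every admissible competitor has energy at least `N(N+2)/|B₁|`. -/
lemma le_integral_norm_gradient_sq {N : ℕ} (hN : 1 ≤ N) {u : EuclideanSpace ℝ (Fin N) → ℝ}
    (hu : ContDiff ℝ 1 u) (hc : HasCompactSupport u) (hsupp : tsupport u ⊆ Metric.ball 0 1)
    (h1 : ∫ x, u x = 1) :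
    (N * (N + 2) : ℝ) / volume.real (Metric.ball (0 : EuclideanSpace ℝ (Fin N)) 1) ≤
      ∫ x, ‖gradient u x‖ ^ 2 := by
  set B := Metric.ball (0 : EuclideanSpace ℝ (Fin N)) 1
  have hV : 0 < volume.real B := ENNReal.toReal_pos (Metric.measure_ball_pos _ _ one_pos).ne' measure_ball_lt_top.ne
  set V := volume.real B
  set c : ℝ := (N + 2) / V with hcdef
  have hcontf : Continuous (fderiv ℝ u) := hu.continuous_fderiv one_ne_zero
  have hzero : ∀ x ∉ B, fderiv ℝ u x = 0 := fun x hx ↦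
    image_eq_zero_of_notMem_tsupport fun h ↦ hx (hsupp (tsupport_fderiv_subset ℝ h))
  have hI1 : Integrable fun x ↦ fderiv ℝ u x x :=
    (hcontf.clm_apply continuous_id).integrable_of_hasCompactSupport
      ((hc.fderiv ℝ).mono fun x hx h ↦ hx (by simp [h]))
  have hI2 : Integrable fun x ↦ ‖gradient u x‖ ^ 2 := by
    simp_rw [norm_gradient_eq_norm_fderiv]
    exact (hcontf.norm.pow 2).integrable_of_hasCompactSupport
      ((hc.fderiv ℝ).mono fun x hx h ↦ hx (by simp [h]))
  have hI3 : Integrable (B.indicator fun x : EuclideanSpace ℝ (Fin N) ↦ ‖x‖ ^ 2) := by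
    rw [integrable_indicator_iff Metric.isOpen_ball.measurableSet]
    exact integrableOn_ball_norm_sq
  have hpt : ∀ x, -(2 * c) * fderiv ℝ u x x - c ^ 2 * B.indicator (fun x ↦ ‖x‖ ^ 2) x ≤
      ‖gradient u x‖ ^ 2 := by
    intro x
    by_cases hx : x ∈ B
    · rw [indicator_of_mem hx, ← inner_gradient_left]
      have h := norm_add_sq_real (gradient u x) (c • x)
      rw [inner_smul_right, norm_smul, mul_pow, Real.norm_eq_abs, sq_abs] at h
      nlinarith [sq_nonneg ‖gradient u x + c • x‖]
    · simp [indicator_of_notMem hx, hzero x hx, norm_gradient_eq_norm_fderiv]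
  have key := integral_mono ((hI1.const_mul (-(2 * c))).sub (hI3.const_mul (c ^ 2))) hI2 hpt
  simp only [Pi.sub_apply] at key
  rw [integral_sub (hI1.const_mul _) (hI3.const_mul _), integral_const_mul, integral_const_mul,
    integral_indicator Metric.isOpen_ball.measurableSet, setIntegral_ball_norm_sq hN,
    integral_fderiv_apply_self hu hc, h1] at key
  refine le_trans (le_of_eq ?_) key
  change _ = -(2 * c) * -(N * 1) - c ^ 2 * (N / (N + 2) * V)
  rw [hcdef]
  field_simp
  ring

/-- A smooth approximation of the positive part that vanishes near `(-∞, 0]`. -/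
lemma exists_smooth_approx_posPart {δ : ℝ} (hδ : 0 < δ) : ∃ φ : ℝ → ℝ,
    ContDiff ℝ (⊤ : ℕ∞) φ ∧ (∀ s, 0 ≤ φ s) ∧ (∀ s ≤ δ, φ s = 0) ∧
    (∀ s, s - 2 * δ ≤ φ s) ∧ (∀ s, |deriv φ s| ≤ 1) := by
  set g : ℝ → ℝ := fun r ↦ Real.smoothTransition (r / δ - 1)
  have hgc : Continuous g := Real.smoothTransition.continuous.comp (by fun_prop)
  have hgi : ∀ a b, IntervalIntegrable g volume a b := fun a b ↦ hgc.intervalIntegrable a b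
  have hg0 : ∀ r, 0 ≤ g r := fun r ↦ Real.smoothTransition.nonneg _
  have hgz : ∀ r ≤ δ, g r = 0 := fun r hr ↦ Real.smoothTransition.zero_of_nonpos <| by
    rw [sub_nonpos, div_le_one hδ]
    exact hr
  have hg1 : ∀ r, 2 * δ ≤ r → g r = 1 := fun r hr ↦ Real.smoothTransition.one_of_one_le <| by
    rw [le_sub_iff_add_le, le_div_iff₀ hδ]
    linarith
  have hderiv : ∀ s, HasDerivAt (fun s ↦ ∫ r in δ..s, g r) (g s) s := fun s ↦
    intervalIntegral.integral_hasDerivAt_right (hgi _ _)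
      (hgc.stronglyMeasurableAtFilter _ _) hgc.continuousAt
  have hz : ∀ s ≤ δ, ∫ r in δ..s, g r = 0 := by
    intro s hs
    rw [intervalIntegral.integral_congr (g := fun _ ↦ 0)]
    · simp
    · intro r hr
      rw [uIcc_of_ge hs] at hr
      exact hgz r hr.2
  have hn : ∀ s, 0 ≤ ∫ r in δ..s, g r := by
    intro s
    rcases le_total s δ with hs | hs
    · exact (hz s hs).ge
    · exact intervalIntegral.integral_nonneg hs fun r _ ↦ hg0 r
  refine ⟨fun s ↦ ∫ r in δ..s, g r, ?_, hn, hz, ?_, ?_⟩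
  · rw [contDiff_infty_iff_deriv]
    refine ⟨fun s ↦ (hderiv s).differentiableAt, ?_⟩
    rw [funext fun s ↦ (hderiv s).deriv]
    exact Real.smoothTransition.contDiff.comp (by fun_prop)
  · intro s
    rcases le_total s (2 * δ) with hs | hs
    · linarith [hn s]
    · have htail : ∫ r in (2 * δ)..s, g r = s - 2 * δ := by
        rw [intervalIntegral.integral_congr (g := fun _ ↦ 1)]
        · simp
        · intro r hr
          rw [uIcc_of_le hs] at hr
          exact hg1 r hr.1
      have := intervalIntegral.integral_add_adjacent_intervals (hgi δ (2 * δ)) (hgi (2 * δ) s)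
      have h0 := hn (2 * δ)
      change s - 2 * δ ≤ ∫ r in δ..s, g r
      linarith
  · intro s
    rw [(hderiv s).deriv, abs_of_nonneg (hg0 s)]
    exact Real.smoothTransition.le_one _

/-- Smooth, compactly supported approximations of the torsion profile `1 - ‖x‖²`. -/
lemma exists_approx_torsion_profile {N : ℕ} (hN : 1 ≤ N) {δ : ℝ} (hδ : 0 < δ) :
    ∃ v : EuclideanSpace ℝ (Fin N) → ℝ, ContDiff ℝ (⊤ : ℕ∞) v ∧ HasCompactSupport v ∧
      tsupport v ⊆ Metric.ball 0 1 ∧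
      (2 / (N + 2) - 2 * δ) * volume.real (Metric.ball (0 : EuclideanSpace ℝ (Fin N)) 1) ≤
        ∫ x, v x ∧
      ∫ x, ‖gradient v x‖ ^ 2 ≤
        4 * (N / (N + 2) * volume.real (Metric.ball (0 : EuclideanSpace ℝ (Fin N)) 1)) := by
  obtain ⟨φ, hφ, hφ0, hφz, hφl, hφd⟩ := exists_smooth_approx_posPart hδ
  set B := Metric.ball (0 : EuclideanSpace ℝ (Fin N)) 1
  have hBm : MeasurableSet B := Metric.isOpen_ball.measurableSet
  set v : EuclideanSpace ℝ (Fin N) → ℝ := fun x ↦ φ (1 - ‖x‖ ^ 2)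
  have hv : ContDiff ℝ (⊤ : ℕ∞) v := hφ.comp (contDiff_const.sub (contDiff_norm_sq ℝ))
  have hts : tsupport v ⊆ {x | ‖x‖ ^ 2 ≤ 1 - δ} := by
    refine closure_minimal (fun x hx ↦ ?_) (isClosed_le (by fun_prop) continuous_const)
    by_contra h
    simp only [mem_ofPred_eq, not_le] at h
    exact hx (hφz _ (by linarith))
  have htB : tsupport v ⊆ B := fun x hx ↦ by
    have h : ‖x‖ ^ 2 ≤ 1 - δ := hts hx
    rw [mem_ball_zero_iff]
    nlinarith [norm_nonneg x]
  have hvc : HasCompactSupport v := HasCompactSupport.of_support_subset_isCompact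
    (isCompact_closedBall (0 : EuclideanSpace ℝ (Fin N)) 1)
    ((subset_tsupport v).trans (htB.trans Metric.ball_subset_closedBall))
  have hIn : IntegrableOn (fun x : EuclideanSpace ℝ (Fin N) ↦ ‖x‖ ^ 2) B :=
    integrableOn_ball_norm_sq
  have hIc : ∀ c : ℝ, IntegrableOn (fun _ : EuclideanSpace ℝ (Fin N) ↦ c) B := fun c ↦
    integrableOn_const measure_ball_lt_top.ne
  have hvi : Integrable v := hv.continuous.integrable_of_hasCompactSupport hvc
  refine ⟨v, hv, hvc, htB, ?_, ?_⟩
  · calc (2 / (N + 2) - 2 * δ) * volume.real B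
        = ∫ x in B, ((1 - 2 * δ) - ‖x‖ ^ 2) := by
          rw [integral_sub (hIc _) hIn, setIntegral_const, setIntegral_ball_norm_sq hN,
            smul_eq_mul]
          change _ = _ - N / (N + 2) * volume.real B
          field_simp
          ring
      _ ≤ ∫ x in B, v x := integral_mono (Integrable.sub (hIc _) hIn) hvi.integrableOn fun x ↦ by
          have := hφl (1 - ‖x‖ ^ 2)
          change _ ≤ φ (1 - ‖x‖ ^ 2)
          linarith
      _ ≤ ∫ x, v x := setIntegral_le_integral hvi (Eventually.of_forall fun x ↦ hφ0 _)
  · have hgrad : ∀ x, ‖gradient v x‖ ^ 2 ≤ 4 * B.indicator (fun x ↦ ‖x‖ ^ 2) x := by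
      intro x
      rw [norm_gradient_eq_norm_fderiv]
      by_cases hx : x ∈ B
      · have hd : HasDerivAt φ (deriv φ (1 - ‖x‖ ^ 2)) (1 - ‖x‖ ^ 2) :=
          (hφ.differentiable (by simp) _).hasDerivAt
        have hf := hd.comp_hasFDerivAt x ((hasStrictFDerivAt_norm_sq x).hasFDerivAt.const_sub 1)
        have hfd : fderiv ℝ v x = deriv φ (1 - ‖x‖ ^ 2) • -(2 • innerSL ℝ x) := hf.fderiv
        have hnorm : ‖fderiv ℝ v x‖ = |deriv φ (1 - ‖x‖ ^ 2)| * (2 * ‖x‖) := by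
          rw [hfd, norm_smul, norm_neg, Real.norm_eq_abs, ← Nat.cast_smul_eq_nsmul ℝ, norm_smul,
            innerSL_apply_norm]
          simp
        rw [indicator_of_mem hx, hnorm, mul_pow]
        have : |deriv φ (1 - ‖x‖ ^ 2)| ^ 2 ≤ 1 := pow_le_one₀ (abs_nonneg _) (hφd _)
        nlinarith [sq_nonneg ‖x‖]
      · rw [image_eq_zero_of_notMem_tsupport fun h ↦ hx (htB (tsupport_fderiv_subset ℝ h))]
        simp [indicator_of_notMem hx]
    have hind : Integrable (B.indicator fun x : EuclideanSpace ℝ (Fin N) ↦ ‖x‖ ^ 2) :=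
      (integrable_indicator_iff hBm).2 hIn
    refine (integral_mono_of_nonneg (Eventually.of_forall fun x ↦ by positivity)
      (hind.const_mul 4) (Eventually.of_forall hgrad)).trans (le_of_eq ?_)
    rw [integral_const_mul, integral_indicator hBm, setIntegral_ball_norm_sq hN]

/-- The torsional energy of the unit ball equals `N(N+2)/|B₁|`. -/
theorem torsionEnergy_unit_ball (N : ℕ) (hN : 1 ≤ N) :
    torsionEnergy (Metric.ball (0 : EuclideanSpace ℝ (Fin N)) 1) =
      (N * (N + 2) : ℝ) /
        (volume (Metric.ball (0 : EuclideanSpace ℝ (Fin N)) 1)).toReal := by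
  change _ = (N * (N + 2) : ℝ) / volume.real (Metric.ball (0 : EuclideanSpace ℝ (Fin N)) 1)
  have hV : 0 < volume.real (Metric.ball (0 : EuclideanSpace ℝ (Fin N)) 1) :=
    ENNReal.toReal_pos (Metric.measure_ball_pos _ _ one_pos).ne' measure_ball_lt_top.ne
  set V := volume.real (Metric.ball (0 : EuclideanSpace ℝ (Fin N)) 1)
  have hlow : ∀ e ∈ {e : ℝ | ∃ u : EuclideanSpace ℝ (Fin N) → ℝ,
      ContDiff ℝ (⊤ : ℕ∞) u ∧ HasCompactSupport u ∧ tsupport u ⊆ Metric.ball 0 1 ∧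
      (∫ x, u x) = 1 ∧ e = ∫ x, ‖gradient u x‖ ^ 2}, (N * (N + 2) : ℝ) / V ≤ e := by
    rintro e ⟨u, hu, hc, hs, h1, rfl⟩
    exact le_integral_norm_gradient_sq hN (hu.of_le (by exact_mod_cast le_top)) hc hs h1
  have hup : ∀ δ : ℝ, 0 < δ → δ < 1 / (N + 2) → ∃ e ∈ {e : ℝ | ∃ u : EuclideanSpace ℝ (Fin N) → ℝ,
      ContDiff ℝ (⊤ : ℕ∞) u ∧ HasCompactSupport u ∧ tsupport u ⊆ Metric.ball 0 1 ∧
      (∫ x, u x) = 1 ∧ e = ∫ x, ‖gradient u x‖ ^ 2},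
      e ≤ 4 * (N / (N + 2) * V) / ((2 / (N + 2) - 2 * δ) * V) ^ 2 := by
    intro δ hδ hδ'
    obtain ⟨v, hv, hvc, hvs, hvI, hvE⟩ := exists_approx_torsion_profile hN hδ
    have hm : 0 < (2 / (N + 2) - 2 * δ) * V := by
      refine mul_pos ?_ hV
      have : (2 : ℝ) / (N + 2) = 2 * (1 / (N + 2)) := by ring
      linarith
    have hI : 0 < ∫ x, v x := hm.trans_le hvI
    refine ⟨_, ⟨fun x ↦ (∫ x, v x)⁻¹ * v x, contDiff_const.mul hv, hvc.mul_left,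
      (tsupport_mul_subset_right).trans hvs, ?_, rfl⟩, ?_⟩
    · rw [integral_const_mul, inv_mul_cancel₀ hI.ne']
    · have hg : ∀ x, ‖gradient (fun x ↦ (∫ x, v x)⁻¹ * v x) x‖ ^ 2 =
          ((∫ x, v x) ^ 2)⁻¹ * ‖gradient v x‖ ^ 2 := by
        intro x
        rw [norm_gradient_eq_norm_fderiv, norm_gradient_eq_norm_fderiv,
          fderiv_const_mul (hv.differentiable (by simp) x), norm_smul, mul_pow, norm_inv,
          Real.norm_of_nonneg hI.le, inv_pow]
      simp_rw [hg]
      rw [integral_const_mul, inv_mul_eq_div]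
      gcongr
  have hbdd := (⟨_, hlow⟩ : BddBelow _)
  have hev : ∀ᶠ δ in 𝓝[>] (0 : ℝ), torsionEnergy (Metric.ball (0 : EuclideanSpace ℝ (Fin N)) 1) ≤
      4 * (N / (N + 2) * V) / ((2 / (N + 2) - 2 * δ) * V) ^ 2 := by
    filter_upwards [Ioo_mem_nhdsGT (show (0 : ℝ) < 1 / (N + 2) by positivity)] with δ hδ
    obtain ⟨e, he, hle⟩ := hup δ hδ.1 hδ.2
    exact (csInf_le hbdd he).trans hle
  have hlim : Tendsto (fun δ : ℝ ↦ 4 * (N / (N + 2) * V) / ((2 / (N + 2) - 2 * δ) * V) ^ 2)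
      (𝓝[>] 0) (𝓝 ((N * (N + 2) : ℝ) / V)) := by
    have hval : (N * (N + 2) : ℝ) / V =
        4 * (N / (N + 2) * V) / ((2 / (N + 2) - 2 * 0) * V) ^ 2 := by
      field_simp
      norm_num
    rw [hval]
    refine (ContinuousAt.tendsto (x := (0 : ℝ)) ?_).mono_left nhdsWithin_le_nhds
    refine ContinuousAt.div (by fun_prop) (by fun_prop) ?_
    rw [mul_zero, sub_zero]
    positivity
  refine le_antisymm (ge_of_tendsto hlim hev) (le_csInf ?_ hlow)
  obtain ⟨δ, hδ0, hδ1⟩ := exists_between (show (0 : ℝ) < 1 / (N + 2) by positivity)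
  obtain ⟨e, he, -⟩ := hup δ hδ0 hδ1
  exact ⟨e, he⟩
end

section
/- Let N ≥ 1 be a natural number, let Ω ⊆ ℝ^N be a nonempty bounded open set, and let r > 0. Then J(r•Ω) = r^{−(N+2)} · J(Ω), where r•Ω := { r·x : x ∈ Ω } is the dilation of Ω by the factor r. -/
open MeasureTheory

open scoped Pointwise

/-- The Dirichlet energies of the admissible functions in the definition of `torsionEnergy`. -/
def dirichletEnergies {N : ℕ} (Ω : Set (EuclideanSpace ℝ (Fin N))) : Set ℝ :=
  { e : ℝ | ∃ u : EuclideanSpace ℝ (Fin N) → ℝ,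
    ContDiff ℝ (⊤ : ℕ∞) u ∧ HasCompactSupport u ∧ tsupport u ⊆ Ω ∧
    (∫ x, u x) = 1 ∧ e = ∫ x, ‖gradient u x‖ ^ 2 }

theorem gradient_const_mul_comp_smul {E : Type*} [NormedAddCommGroup E] [InnerProductSpace ℝ E]
    [CompleteSpace E] {u : E → ℝ} (hu : Differentiable ℝ u) (c s : ℝ) (x : E) :
    gradient (fun y => c * u (s • y)) x = (c * s) • gradient u (s • x) := by
  have hus : DifferentiableAt ℝ (fun y => u (s • y)) x := by fun_prop
  simp only [gradient]
  rw [fderiv_const_mul hus, fderiv_comp_smul, smul_smul, map_smulₛₗ]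
  simp

theorem smul_mem_dirichletEnergies {N : ℕ} {Ω : Set (EuclideanSpace ℝ (Fin N))} {r : ℝ}
    (hr : 0 < r) {e : ℝ} (he : e ∈ dirichletEnergies Ω) :
    r ^ (-((N : ℤ) + 2)) * e ∈ dirichletEnergies ((fun x => r • x) '' Ω) := by
  obtain ⟨u, hu, hcs, hΩ, hint, rfl⟩ := he
  have habs : |((r⁻¹ ^ N)⁻¹ : ℝ)| = r ^ N := by
    rw [inv_pow, inv_inv, abs_of_pos (pow_pos hr N)]
  refine ⟨fun x => (r ^ N)⁻¹ * u (r⁻¹ • x), by fun_prop, ?_, ?_, ?_, ?_⟩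
  · exact (hcs.comp_smul (inv_ne_zero hr.ne')).mul_left
  · refine (tsupport_mul_subset_right (f := fun _ => (r ^ N)⁻¹)).trans fun x hx => ?_
    have hmem : r⁻¹ • x ∈ tsupport u :=
      tsupport_comp_subset_preimage u (continuous_const_smul r⁻¹) hx
    exact ⟨r⁻¹ • x, hΩ hmem, smul_inv_smul₀ hr.ne' x⟩
  · rw [integral_const_mul, Measure.integral_comp_smul volume u, hint, finrank_euclideanSpace_fin,
      habs, smul_eq_mul, mul_one, inv_mul_cancel₀ (pow_pos hr N).ne']
  · simp_rw [gradient_const_mul_comp_smul (hu.differentiable (by simp)), norm_smul, mul_pow]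
    rw [integral_const_mul, Measure.integral_comp_smul volume (fun x => ‖gradient u x‖ ^ 2),
      finrank_euclideanSpace_fin, habs, smul_eq_mul, ← mul_assoc, Real.norm_eq_abs, sq_abs,
      zpow_neg, zpow_add₀ hr.ne', zpow_natCast]
    congr 1
    norm_cast
    field_simp

theorem dirichletEnergies_smul {N : ℕ} (Ω : Set (EuclideanSpace ℝ (Fin N))) {r : ℝ}
    (hr : 0 < r) :
    dirichletEnergies ((fun x => r • x) '' Ω) =
      (r ^ (-((N : ℤ) + 2))) • dirichletEnergies Ω := by
  ext e
  rw [Set.mem_smul_set]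
  constructor
  · intro he
    have h := smul_mem_dirichletEnergies (inv_pos.2 hr) he
    simp only [Set.image_image, inv_smul_smul₀ hr.ne', Set.image_id'] at h
    refine ⟨_, h, ?_⟩
    rw [smul_eq_mul, ← mul_assoc, ← mul_zpow, mul_inv_cancel₀ hr.ne', one_zpow, one_mul]
  · rintro ⟨e, he, rfl⟩
    exact smul_mem_dirichletEnergies hr he

/-- Scaling law for the torsional energy: `J(rΩ) = r^{-(N+2)} J(Ω)`. -/
theorem torsionEnergy_smul (N : ℕ) (hN : 1 ≤ N)
    (Ω : Set (EuclideanSpace ℝ (Fin N))) (hΩo : IsOpen Ω)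
    (hΩb : Bornology.IsBounded Ω) (hΩne : Ω.Nonempty) (r : ℝ) (hr : 0 < r) :
    torsionEnergy ((fun x => r • x) '' Ω) = r ^ (-((N : ℤ) + 2)) * torsionEnergy Ω := by
  change sInf (dirichletEnergies _) = _ * sInf (dirichletEnergies Ω)
  rw [dirichletEnergies_smul Ω hr, Real.sInf_smul_of_nonneg (zpow_nonneg hr.le _), smul_eq_mul]
end

section
/- For every natural number N ≥ 2, |B₁|² ≠ N²(N+2)³/(N+4), where |B₁| denotes the Lebesgue volume of the unit ball in ℝ^N. Equivalently, the constant β_N := (N²(N+2)³ − (N+4)|B₁|²)/(2N²(N+2)(N+4)) is nonzero for every N ≥ 2. -/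
open MeasureTheory

/-- The volume of the unit ball in dimension `n + 1` is at most `2 (n + 1)`. -/
lemma sqrt_pi_pow_div_Gamma_le (n : ℕ) :
    √Real.pi ^ (n + 1) / Real.Gamma (((n + 1 : ℕ) : ℝ) / 2 + 1) ≤ 2 * ((n + 1 : ℕ) : ℝ) := by
  have hpi : 0 < √Real.pi := Real.sqrt_pos.mpr Real.pi_pos
  induction n using Nat.twoStepInduction with
  | zero =>
    have h : Real.Gamma (((0 + 1 : ℕ) : ℝ) / 2 + 1) = 1 / 2 * √Real.pi := by
      rw [← Real.Gamma_one_half_eq, ← Real.Gamma_add_one (by norm_num)]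
      norm_num
    rw [h, div_le_iff₀ (by positivity)]
    push_cast
    linarith
  | one =>
    have h : Real.Gamma (((1 + 1 : ℕ) : ℝ) / 2 + 1) = 1 := by
      norm_num
    rw [h, div_one, Real.sq_sqrt Real.pi_pos.le]
    norm_num
    linarith [Real.pi_lt_d2]
  | more n ih _ =>
    have hG : 0 < Real.Gamma (((n + 1 : ℕ) : ℝ) / 2 + 1) := Real.Gamma_pos_of_pos (by positivity)
    have hrec : Real.Gamma (((n + 2 + 1 : ℕ) : ℝ) / 2 + 1) =
        (((n + 1 : ℕ) : ℝ) / 2 + 1) * Real.Gamma (((n + 1 : ℕ) : ℝ) / 2 + 1) := by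
      rw [← Real.Gamma_add_one (by positivity)]
      congr 1
      push_cast
      ring
    have hpow : √Real.pi ^ (n + 2 + 1) = Real.pi * √Real.pi ^ (n + 1) := by
      rw [show n + 2 + 1 = 2 + (n + 1) by ring, pow_add, Real.sq_sqrt Real.pi_pos.le]
    rw [hrec, hpow, mul_div_mul_comm]
    calc Real.pi / (((n + 1 : ℕ) : ℝ) / 2 + 1) *
          (√Real.pi ^ (n + 1) / Real.Gamma (((n + 1 : ℕ) : ℝ) / 2 + 1))
        ≤ Real.pi / (((n + 1 : ℕ) : ℝ) / 2 + 1) * (2 * ((n + 1 : ℕ) : ℝ)) := by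
          gcongr
      _ ≤ 2 * ((n + 2 + 1 : ℕ) : ℝ) := by
          rw [div_mul_eq_mul_div, div_le_iff₀ (by positivity)]
          push_cast
          have hn : (0 : ℝ) ≤ n := n.cast_nonneg
          nlinarith [mul_le_mul_of_nonneg_right Real.pi_lt_d2.le (by positivity : (0 : ℝ) ≤ n + 1),
            sq_nonneg ((n : ℝ) - 1)]

/-- The constant `β_N = (N²(N+2)³ − (N+4)|B₁|²)/(2N²(N+2)(N+4))` is nonzero for all `N ≥ 2`,
equivalently `|B₁|² ≠ N²(N+2)³/(N+4)`. -/
theorem betaN_ne_zero (N : ℕ) (hN : 2 ≤ N) :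
    (volume (Metric.ball (0 : EuclideanSpace ℝ (Fin N)) 1)).toReal ^ 2 ≠
      ((N : ℝ) ^ 2 * ((N : ℝ) + 2) ^ 3) / ((N : ℝ) + 4) := by
  have hNpos : (0 : ℝ) < N := by exact_mod_cast (by omega : 0 < N)
  have hV : (volume (Metric.ball (0 : EuclideanSpace ℝ (Fin N)) 1)).toReal ≤ 2 * N := by
    have : Nonempty (Fin N) := ⟨⟨0, by omega⟩⟩
    rw [EuclideanSpace.volume_ball, Fintype.card_fin, ENNReal.ofReal_one, one_pow, one_mul]
    obtain ⟨n, rfl⟩ : ∃ n, N = n + 1 := ⟨N - 1, by omega⟩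
    have hG : 0 < Real.Gamma (((n + 1 : ℕ) : ℝ) / 2 + 1) := Real.Gamma_pos_of_pos (by positivity)
    rw [ENNReal.toReal_ofReal (by positivity)]
    exact sqrt_pi_pow_div_Gamma_le n
  apply ne_of_lt
  calc _ ≤ (2 * (N : ℝ)) ^ 2 := by gcongr
    _ < _ := by
      have hN2 : (2 : ℝ) ≤ N := by exact_mod_cast hN
      have h : 4 * ((N : ℝ) + 4) < ((N : ℝ) + 2) ^ 3 := by nlinarith [pow_pos hNpos 3]
      rw [lt_div_iff₀ (by positivity)]
      calc (2 * (N : ℝ)) ^ 2 * (N + 4) = (N : ℝ) ^ 2 * (4 * (N + 4)) := by ring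
        _ < (N : ℝ) ^ 2 * ((N : ℝ) + 2) ^ 3 := by gcongr
end
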